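/- Let 1 < α < 2, 0 ≤ p ≤ 1, and let μ, ν ∈ [α−2, 0] satisfy μ + ν = α − 2 and p·sin(πμ) = (1−p)·sin(πν). Then for all integers k ≥ 1 and n ≥ k and every x ∈ (−1,1), (d/dx)^k (I_p^{2−α} J_n^{−μ,−ν})(x) = ( Γ(n+k+α−1) / ( 2^k Γ(n+1) ) )·P_{n−k}^{ν+k, μ+k}(x). -/

import Mathlib

open MeasureTheory Real Set Finset

noncomputable section

/-- The interval Λ = (−1, 1). -/
def Lam : Set ℝ := Set.Ioo (-1 : ℝ) 1

/-- Left Riemann–Liouville fractional integral of order `σ` on `(−1,1)`;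
`Il 0` is the identity. -/
def Il (σ : ℝ) (v : ℝ → ℝ) (x : ℝ) : ℝ :=
  if σ = 0 then v x
  else (1 / Real.Gamma σ) * ∫ y in (-1 : ℝ)..x, (x - y) ^ (σ - 1) * v y

/-- Right Riemann–Liouville fractional integral of order `σ` on `(−1,1)`;
`Ir 0` is the identity. -/
def Ir (σ : ℝ) (v : ℝ → ℝ) (x : ℝ) : ℝ :=
  if σ = 0 then v x
  else (1 / Real.Gamma σ) * ∫ y in x..(1 : ℝ), (y - x) ^ (σ - 1) * v y

/-- The constant `C_{α,p} = (sin(πμ) + sin(πν)) / sin(πα)`. -/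
def Cap (α μ ν : ℝ) : ℝ := (Real.sin (π * μ) + Real.sin (π * ν)) / Real.sin (π * α)

/-- Two-sided fractional integral `I_p^σ v = C_{α,p}(p I_l^σ v + (1−p) I_r^σ v)`. -/
def Ip (α μ ν p σ : ℝ) (v : ℝ → ℝ) (x : ℝ) : ℝ :=
  Cap α μ ν * (p * Il σ v x + (1 - p) * Ir σ v x)

/-- Two-sided Riemann–Liouville fractional derivative of order `α − 1`. -/
def Dp (α μ ν p : ℝ) (v : ℝ → ℝ) : ℝ → ℝ := deriv (Ip α μ ν p (2 - α) v)

/-- Jacobi polynomial `P_n^{a,b}` given by its explicit hypergeometric sum. -/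
def jacobiP (n : ℕ) (a b : ℝ) (x : ℝ) : ℝ :=
  ∑ m ∈ Finset.range (n + 1),
    (Real.Gamma (a + n + 1) * Real.Gamma (a + b + n + m + 1)) /
      ((m.factorial : ℝ) * ((n - m).factorial : ℝ) * Real.Gamma (a + b + n + 1) *
        Real.Gamma (a + m + 1)) * ((x - 1) / 2) ^ m

/-- Jacobi poly-fractonomial `J_n^{−a,−b}(x) = (1−x)^a (1+x)^b P_n^{a,b}(x)`. -/
def Jpf (n : ℕ) (a b : ℝ) (x : ℝ) : ℝ :=
  (1 - x) ^ a * (1 + x) ^ b * jacobiP n a b x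

/-- Membership in the fractional derivative space `H_RL^{α−1}(Λ)`. -/
def MemH (α μ ν p : ℝ) (v : ℝ → ℝ) : Prop :=
  IntegrableOn (fun x => (Ip α μ ν p (2 - α) v x) ^ 2) Lam ∧
    IntegrableOn (fun x => (Dp α μ ν p v x) ^ 2) Lam

/-- Squared norm of `H_RL^{α−1}(Λ)`. -/
def HnormSq (α μ ν p : ℝ) (v : ℝ → ℝ) : ℝ :=
  (∫ x in Lam, (Ip α μ ν p (2 - α) v x) ^ 2) + ∫ x in Lam, (Dp α μ ν p v x) ^ 2

/-- The bilinear form `A(u,v) = c(u, I_p^{2−α}v) + (D_p^{α−1}u, D_p^{α−1}v)`. -/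
def Aform (α μ ν p c : ℝ) (u v : ℝ → ℝ) : ℝ :=
  c * (∫ x in Lam, u x * Ip α μ ν p (2 - α) v x) +
    ∫ x in Lam, Dp α μ ν p u x * Dp α μ ν p v x

/-- Incomplete Fourier transform `F^c(w)(ξ) = (1/2π) ∫_{−1}^1 w(x) e^{iξx} dx`. -/
def Fc (w : ℝ → ℝ) (ξ : ℝ) : ℂ :=
  ((1 / (2 * π) : ℝ) : ℂ) *
    ∫ x in (-1 : ℝ)..1, (w x : ℂ) * Complex.exp (Complex.I * ξ * x)


/-- Euler's integral `∫₀¹ t^b (1-t)^(s-1) (1-ξt)^a dt` for the hypergeometric function. -/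
def eulerIntegral (s a b ξ : ℝ) : ℝ :=
  ∫ t in (0 : ℝ)..1, t ^ b * (1 - t) ^ (s - 1) * (1 - ξ * t) ^ a

theorem intervalIntegrable_beta {s b : ℝ} (hs : 0 < s) (hb : -1 < b) :
    IntervalIntegrable (fun t : ℝ => t ^ b * (1 - t) ^ (s - 1)) volume 0 1 := by
  have h := Complex.betaIntegral_convergent (u := ((b + 1 : ℝ) : ℂ)) (v := (s : ℂ))
    (by simp; linarith) (by simpa using hs)
  rw [intervalIntegrable_iff_integrableOn_Ioo_of_le zero_le_one] at h ⊢
  refine IntegrableOn.congr_fun (h.re : IntegrableOn _ _ _) (fun t ht => ?_) measurableSet_Ioo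
  have h1 : (1 - (t : ℂ)) = ((1 - t : ℝ) : ℂ) := by push_cast; rfl
  have h2 : (((b + 1 : ℝ) : ℂ) - 1) = ((b : ℝ) : ℂ) := by push_cast; ring
  have h3 : ((s : ℂ) - 1) = ((s - 1 : ℝ) : ℂ) := by push_cast; rfl
  simp only [h1, h2, h3]
  rw [← Complex.ofReal_cpow ht.1.le, ← Complex.ofReal_cpow (by linarith [ht.2]),
    ← Complex.ofReal_mul]
  rfl

theorem integral_beta {s b : ℝ} (hs : 0 < s) (hb : -1 < b) :
    ∫ t in (0 : ℝ)..1, t ^ b * (1 - t) ^ (s - 1) =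
      Gamma (b + 1) * Gamma s / Gamma (b + 1 + s) := by
  have h := Complex.betaIntegral_eq_Gamma_mul_div ((b + 1 : ℝ) : ℂ) (s : ℂ)
    (by simp; linarith) (by simpa using hs)
  rw [Complex.betaIntegral, ← Complex.ofReal_add, Complex.Gamma_ofReal, Complex.Gamma_ofReal,
    Complex.Gamma_ofReal] at h
  apply Complex.ofReal_injective
  push_cast
  rw [← h, ← intervalIntegral.integral_ofReal]
  refine intervalIntegral.integral_congr fun t ht => ?_
  rw [Set.uIcc_of_le zero_le_one] at ht
  have h1 : (1 - (t : ℂ)) = ((1 - t : ℝ) : ℂ) := by push_cast; rfl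
  have h2 : (((b + 1 : ℝ) : ℂ) - 1) = ((b : ℝ) : ℂ) := by push_cast; ring
  have h3 : ((s : ℂ) - 1) = ((s - 1 : ℝ) : ℂ) := by push_cast; rfl
  simp only [h1, h2, h3]
  rw [← Complex.ofReal_cpow ht.1, ← Complex.ofReal_cpow (by linarith [ht.2]),
    ← Complex.ofReal_mul]

theorem one_sub_mul_pos {ξ t : ℝ} (hξ : ξ < 1) (ht : t ∈ Set.Icc (0 : ℝ) 1) : 0 < 1 - ξ * t := by
  rcases le_or_gt ξ 0 with h | h
  · nlinarith [mul_nonneg (neg_nonneg.2 h) ht.1]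
  · nlinarith [mul_le_mul_of_nonneg_left ht.2 h.le]

theorem intervalIntegrable_euler {s b ξ : ℝ} (a : ℝ) (hs : 0 < s) (hb : -1 < b) (hξ : ξ < 1) :
    IntervalIntegrable (fun t : ℝ => t ^ b * (1 - t) ^ (s - 1) * (1 - ξ * t) ^ a)
      volume 0 1 := by
  refine (intervalIntegrable_beta hs hb).mul_continuousOn ?_
  rw [Set.uIcc_of_le zero_le_one]
  exact ContinuousOn.rpow_const (by fun_prop) fun t ht => Or.inl (one_sub_mul_pos hξ ht).ne'

/-- Contiguity in the exponent of `1 - ξt`. -/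
theorem eulerIntegral_add_one {s b ξ : ℝ} (a : ℝ) (hs : 0 < s) (hb : -1 < b) (hξ : ξ < 1) :
    eulerIntegral s (a + 1) b ξ = eulerIntegral s a b ξ - ξ * eulerIntegral s a (b + 1) ξ := by
  unfold eulerIntegral
  rw [← intervalIntegral.integral_const_mul, ← intervalIntegral.integral_sub
    (intervalIntegrable_euler a hs hb hξ)
    ((intervalIntegrable_euler a hs (by linarith) hξ).const_mul _)]
  rw [intervalIntegral.integral_of_le zero_le_one, intervalIntegral.integral_of_le zero_le_one]
  refine setIntegral_congr_fun measurableSet_Ioc fun t ht => ?_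
  have := one_sub_mul_pos hξ (Ioc_subset_Icc_self ht)
  rw [rpow_add_one this.ne', rpow_add_one ht.1.ne']
  ring

/-- Integration of the total derivative of `t^(b+1) (1-t)^s (1-ξt)^(a+1)`. -/
theorem eulerIntegral_contiguous {s b ξ : ℝ} (a : ℝ) (hs : 0 < s) (hb : -1 < b) (hξ : ξ < 1) :
    (b + 1) * eulerIntegral s a b ξ
      - (s + (b + 1) * (1 + ξ) + (a + 1) * ξ) * eulerIntegral s a (b + 1) ξ
      + ξ * (s + b + a + 2) * eulerIntegral s a (b + 2) ξ = 0 := by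
  have i0 := intervalIntegrable_euler a hs hb hξ
  have i1 := intervalIntegrable_euler (b := b + 1) a hs (by linarith) hξ
  have i2 := intervalIntegrable_euler (b := b + 2) a hs (by linarith) hξ
  have key := intervalIntegral.integral_eq_sub_of_hasDerivAt_of_le zero_le_one
    (f := fun t : ℝ => t ^ (b + 1) * (1 - t) ^ s * (1 - ξ * t) ^ (a + 1))
    (f' := fun t : ℝ => (b + 1) * (t ^ b * (1 - t) ^ (s - 1) * (1 - ξ * t) ^ a)
      - (s + (b + 1) * (1 + ξ) + (a + 1) * ξ) *
        (t ^ (b + 1) * (1 - t) ^ (s - 1) * (1 - ξ * t) ^ a)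
      + ξ * (s + b + a + 2) * (t ^ (b + 2) * (1 - t) ^ (s - 1) * (1 - ξ * t) ^ a)) ?_ ?_
    (((i0.const_mul _).sub (i1.const_mul _)).add (i2.const_mul _))
  · rw [intervalIntegral.integral_add ((i0.const_mul _).sub (i1.const_mul _)) (i2.const_mul _),
      intervalIntegral.integral_sub (i0.const_mul _) (i1.const_mul _)] at key
    simp only [intervalIntegral.integral_const_mul] at key
    unfold eulerIntegral
    rw [key]
    simp [zero_rpow hs.ne', zero_rpow (show b + 1 ≠ 0 by linarith)]
  · refine ((ContinuousOn.rpow_const (by fun_prop) fun t _ => Or.inr (by linarith)).mul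
      (ContinuousOn.rpow_const (by fun_prop) fun t _ => Or.inr hs.le)).mul
      (ContinuousOn.rpow_const (by fun_prop) fun t ht => Or.inl (one_sub_mul_pos hξ ht).ne')
  · intro t ht
    have h1 : 0 < 1 - t := by linarith [ht.2]
    have h2 := one_sub_mul_pos hξ (Ioo_subset_Icc_self ht)
    have d1 := (hasDerivAt_id t).rpow_const (p := b + 1) (Or.inl ht.1.ne')
    have d2 := ((hasDerivAt_id t).const_sub 1).rpow_const (p := s) (Or.inl h1.ne')
    have d3 := (((hasDerivAt_id t).const_mul ξ).const_sub 1).rpow_const (p := a + 1)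
      (Or.inl h2.ne')
    refine ((d1.mul d2).mul d3).congr_deriv ?_
    simp only [id, Pi.mul_apply]
    have e1 : t ^ (b + 2) = t ^ b * t * t := by
      rw [show b + 2 = b + 1 + 1 by ring, rpow_add_one ht.1.ne', rpow_add_one ht.1.ne']
    have e2 : (1 - t) ^ s = (1 - t) ^ (s - 1) * (1 - t) := by
      rw [← rpow_add_one h1.ne']; ring_nf
    rw [e1, e2, rpow_add_one ht.1.ne', rpow_add_one h2.ne']
    simp only [add_sub_cancel_right]
    ring

theorem hasDerivAt_eulerIntegral {s b ξ : ℝ} (a : ℝ) (hs : 0 < s) (hb : -1 < b) (hξ : ξ < 1) :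
    HasDerivAt (eulerIntegral s a b) (-a * eulerIntegral s (a - 1) (b + 1) ξ) ξ := by
  obtain ⟨c, hξc, hc⟩ := exists_between hξ
  have hcont : ContinuousOn (fun q : ℝ × ℝ => -a * (q.2 * (1 - q.1 * q.2) ^ (a - 1)))
      (Set.Icc (ξ - 1) c ×ˢ Set.Icc 0 1) := by
    refine continuousOn_const.mul (continuousOn_snd.mul
      (ContinuousOn.rpow_const (by fun_prop) fun q hq => Or.inl ?_))
    exact (one_sub_mul_pos (hq.1.2.trans_lt hc) hq.2).ne'
  obtain ⟨C, hC⟩ := (isCompact_Icc.prod isCompact_Icc).exists_bound_of_continuousOn hcont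
  have meas : ∀ (a b ξ : ℝ), AEStronglyMeasurable
      (fun t : ℝ => t ^ b * (1 - t) ^ (s - 1) * (1 - ξ * t) ^ a)
      (volume.restrict (uIoc 0 1)) := fun a b ξ => by
    have : Measurable (fun t : ℝ => t ^ b * (1 - t) ^ (s - 1) * (1 - ξ * t) ^ a) := by fun_prop
    exact this.aestronglyMeasurable
  have h := intervalIntegral.hasDerivAt_integral_of_dominated_loc_of_deriv_le
    (μ := volume) (a := 0) (b := 1) (x₀ := ξ) (s := Set.Ioo (ξ - 1) c)
    (F := fun ξ t : ℝ => t ^ b * (1 - t) ^ (s - 1) * (1 - ξ * t) ^ a)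
    (F' := fun ξ t : ℝ => -a * (t ^ (b + 1) * (1 - t) ^ (s - 1) * (1 - ξ * t) ^ (a - 1)))
    (bound := fun t => t ^ b * (1 - t) ^ (s - 1) * C)
    (Ioo_mem_nhds (by linarith) hξc) (Filter.Eventually.of_forall fun x => meas _ _ _)
    (intervalIntegrable_euler a hs hb hξ) ((meas _ _ _).const_mul _) ?_
    ((intervalIntegrable_beta hs hb).mul_const _) ?_
  · have := h.2
    rwa [intervalIntegral.integral_const_mul] at this
  · refine Filter.Eventually.of_forall fun t ht x hx => ?_
    rw [Set.uIoc_of_le zero_le_one] at ht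
    have hb0 : 0 ≤ t ^ b * (1 - t) ^ (s - 1) :=
      mul_nonneg (rpow_nonneg ht.1.le _) (rpow_nonneg (by linarith [ht.2]) _)
    have := hC (x, t) ⟨Ioo_subset_Icc_self hx, Ioc_subset_Icc_self ht⟩
    calc _ = t ^ b * (1 - t) ^ (s - 1) * ‖-a * (t * (1 - x * t) ^ (a - 1))‖ := by
          rw [rpow_add_one ht.1.ne', show -a * (t ^ b * t * (1 - t) ^ (s - 1) * (1 - x * t) ^ (a - 1)) =
            t ^ b * (1 - t) ^ (s - 1) * (-a * (t * (1 - x * t) ^ (a - 1))) by ring, norm_mul,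
            Real.norm_of_nonneg hb0]
      _ ≤ _ := mul_le_mul_of_nonneg_left this hb0
  · refine Filter.Eventually.of_forall fun t ht x hx => ?_
    rw [Set.uIoc_of_le zero_le_one] at ht
    have h2 := one_sub_mul_pos (hx.2.trans hc) (Ioc_subset_Icc_self ht)
    have d3 := (((hasDerivAt_id x).mul_const t).const_sub 1).rpow_const (p := a)
      (Or.inl h2.ne')
    refine (d3.const_mul (t ^ b * (1 - t) ^ (s - 1))).congr_deriv ?_
    rw [rpow_add_one ht.1.ne']
    simp only [id]
    ring

/-- Euler's integral in the case where the exponents sum to `-2`. -/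
theorem eulerIntegral_of_sum_eq {s a b ξ : ℝ} (hs : 0 < s) (hb : -1 < b) (hξ0 : 0 ≤ ξ)
    (hξ : ξ < 1) (hsum : s + a + b = -1) :
    eulerIntegral s a b ξ = (1 - ξ) ^ (-b - 1) * (Gamma (b + 1) * Gamma s / Gamma (b + 1 + s)) := by
  have hden : ∀ t ∈ Set.Ioo (0 : ℝ) 1, 0 < 1 - ξ + ξ * t := fun t ht => by
    nlinarith [mul_nonneg hξ0 ht.1.le]
  have hinv : ∀ t ∈ Set.Ioo (0 : ℝ) 1, t / (1 - ξ + ξ * t) ∈ Set.Ioo (0 : ℝ) 1 := fun t ht => by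
    refine ⟨div_pos ht.1 (hden t ht), ?_⟩
    rw [div_lt_one (hden t ht)]
    nlinarith [ht.2]
  have himg : (fun t => t / (1 - ξ + ξ * t)) '' Set.Ioo (0 : ℝ) 1 = Set.Ioo 0 1 := by
    refine Subset.antisymm (image_subset_iff.2 hinv) fun t ht => ?_
    have h := one_sub_mul_pos hξ (Ioo_subset_Icc_self ht)
    refine ⟨(1 - ξ) * t / (1 - ξ * t), ⟨by have := ht.1; have := sub_pos.2 hξ; positivity, ?_⟩, ?_⟩
    · rw [div_lt_one h]
      linarith [ht.2]
    · have : 1 - ξ + ξ * ((1 - ξ) * t / (1 - ξ * t)) = (1 - ξ) / (1 - ξ * t) := by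
        field_simp
        ring
      simp only [this]
      have := (sub_pos.2 hξ).ne'
      field_simp
  have hinj : InjOn (fun t => t / (1 - ξ + ξ * t)) (Set.Ioo (0 : ℝ) 1) := fun x hx y hy hxy => by
    have h := (sub_pos.2 hξ).ne'
    simp only at hxy
    rw [div_eq_div_iff (hden x hx).ne' (hden y hy).ne'] at hxy
    apply mul_right_cancel₀ h
    linarith
  rw [eulerIntegral, ← integral_beta hs hb, intervalIntegral.integral_of_le zero_le_one,
    intervalIntegral.integral_of_le zero_le_one, integral_Ioc_eq_integral_Ioo,
    integral_Ioc_eq_integral_Ioo, ← integral_const_mul]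
  conv_lhs => rw [← himg]
  rw [integral_image_eq_integral_abs_deriv_smul (f' := fun t => (1 - ξ) / (1 - ξ + ξ * t) ^ 2)
    measurableSet_Ioo ?_ hinj]
  · refine setIntegral_congr_fun measurableSet_Ioo fun t ht => ?_
    have hd := hden t ht
    have hξ' := sub_pos.2 hξ
    have ht1 := sub_pos.2 ht.2
    have ht0 := ht.1
    have e1 : 1 - t / (1 - ξ + ξ * t) = (1 - ξ) * (1 - t) / (1 - ξ + ξ * t) := by
      field_simp
      ring
    have e2 : 1 - ξ * (t / (1 - ξ + ξ * t)) = (1 - ξ) / (1 - ξ + ξ * t) := by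
      field_simp
      ring
    simp only [smul_eq_mul]
    rw [e1, e2, abs_of_pos (by positivity), div_rpow ht0.le hd.le, div_rpow (by positivity) hd.le,
      div_rpow hξ'.le hd.le, mul_rpow hξ'.le ht1.le]
    have e3 : (1 - ξ) ^ (-b - 1) = (1 - ξ) * (1 - ξ) ^ (s - 1) * (1 - ξ) ^ a := by
      rw [mul_comm (1 - ξ), ← rpow_add_one hξ'.ne', ← rpow_add hξ']
      congr 1
      linarith
    have e4 : (1 - ξ + ξ * t) ^ b * (1 - ξ + ξ * t) ^ (s - 1) * (1 - ξ + ξ * t) ^ a *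
        (1 - ξ + ξ * t) ^ 2 = 1 := by
      rw [← rpow_add hd, ← rpow_add hd, ← rpow_natCast, ← rpow_add hd,
        show b + (s - 1) + a + ((2 : ℕ) : ℝ) = 0 by push_cast; linarith, rpow_zero]
    rw [e3]
    have p1 := rpow_pos_of_pos hd b
    have p2 := rpow_pos_of_pos hd (s - 1)
    have p3 := rpow_pos_of_pos hd a
    rw [show ∀ A B C D F : ℝ, A / (1 - ξ + ξ * t) ^ 2 * (B / (1 - ξ + ξ * t) ^ b *
      (C * D / (1 - ξ + ξ * t) ^ (s - 1)) * (F / (1 - ξ + ξ * t) ^ a)) =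
      A * C * F * (B * D) / ((1 - ξ + ξ * t) ^ b * (1 - ξ + ξ * t) ^ (s - 1) *
        (1 - ξ + ξ * t) ^ a * (1 - ξ + ξ * t) ^ 2) from fun A B C D F => by field_simp, e4,
      div_one]
  · intro t ht
    have hd := hden t ht
    refine HasDerivAt.hasDerivWithinAt ?_
    refine ((hasDerivAt_id t).div (((hasDerivAt_id t).const_mul ξ).const_add (1 - ξ))
      hd.ne').congr_deriv ?_
    simp only [id]
    congr 1
    ring

/-- `eulerIntegral_contiguous` rewritten in powers of `1 - ξt`. -/
theorem eulerIntegral_add_two {s b ξ : ℝ} (a : ℝ) (hs : 0 < s) (hb : -1 < b) (hξ : ξ < 1) :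
    (s + b + a + 2) * eulerIntegral s (a + 2) b ξ =
      (s + b + 2 * a + 3 - (a + b + 2) * ξ) * eulerIntegral s (a + 1) b ξ
        - (a + 1) * (1 - ξ) * eulerIntegral s a b ξ := by
  have c := eulerIntegral_contiguous a hs hb hξ
  have h0 := eulerIntegral_add_one a hs hb hξ
  have h1 := eulerIntegral_add_one (b := b + 1) a hs (by linarith) hξ
  have h2 := eulerIntegral_add_one (a + 1) hs hb hξ
  rw [show a + 1 + 1 = a + 2 by ring] at h2
  rw [show b + 1 + 1 = b + 2 by ring] at h1
  rw [h2, h1, h0]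
  linear_combination ξ * c

theorem sin_mul_Gamma_mul_Gamma {x : ℝ} (hx : -1 < x) (hx0 : x < 0) :
    sin (π * x) * (Gamma (x + 1) * Gamma (-x)) = -π := by
  have h := Real.Gamma_mul_Gamma_one_sub (x + 1)
  have hsin : sin (π * x) < 0 :=
    sin_neg_of_neg_of_neg_pi_lt (by nlinarith [pi_pos]) (by nlinarith [pi_pos])
  rw [show 1 - (x + 1) = -x by ring, show π * (x + 1) = π * x + π by ring, sin_add_pi] at h
  rw [h, div_neg, mul_neg, mul_div_cancel₀ _ hsin.ne]

theorem sin_mul_beta {s μ ν : ℝ} (hν : -1 < ν) (hν0 : ν ≤ 0) (hsum : s + μ + ν = 0) :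
    sin (π * ν) * (μ * (Gamma (ν + 1) * Gamma s / Gamma (ν + 1 + s))) =
      π * μ * ν * Gamma s / (Gamma (1 - μ) * Gamma (1 - ν)) := by
  rw [show ν + 1 + s = 1 - μ by linarith]
  rcases hν0.eq_or_lt with rfl | hν0
  · simp
  have h := sin_mul_Gamma_mul_Gamma hν hν0
  have hg : Gamma (1 - ν) = -ν * Gamma (-ν) := by
    rw [← Gamma_add_one (by linarith)]
    ring_nf
  have h0 : Gamma (-ν) ≠ 0 := (Gamma_pos_of_pos (by linarith)).ne'
  rw [hg]
  have : π = -(sin (π * ν) * (Gamma (ν + 1) * Gamma (-ν))) := by linarith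
  nth_rewrite 2 [this]
  have := hν0.ne
  rw [← div_div, div_eq_mul_inv _ (-ν * _), mul_inv]
  field_simp

/-- The two-sided fractional integral of the `m`-th power of `(1 - y)/2` against the weight
`(1 - y)^μ (1 + y)^ν`, up to normalization and in the variable `ξ = (1 + x)/2`. -/
def twoSidedMoment (s μ ν : ℝ) (m : ℕ) (ξ : ℝ) : ℝ :=
  sin (π * ν) * (ξ ^ (-μ) * eulerIntegral s (μ + m) ν ξ) +
    sin (π * μ) * ((1 - ξ) ^ (-ν) * (1 - ξ) ^ m * eulerIntegral s ν (μ + m) (1 - ξ))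

theorem hasDerivAt_rpow_mul_eulerIntegral {s μ ν ξ : ℝ} (hs : 0 < s) (hν : -1 < ν)
    (hsum : s + μ + ν = 0) (hξ : ξ ∈ Set.Ioo (0 : ℝ) 1) :
    HasDerivAt (fun ξ => ξ ^ (-μ) * eulerIntegral s μ ν ξ)
      (-(ξ ^ (-μ - 1) * (1 - ξ) ^ (-ν - 1) *
        (μ * (Gamma (ν + 1) * Gamma s / Gamma (ν + 1 + s))))) ξ := by
  have h1 := (hasDerivAt_id ξ).rpow_const (p := -μ) (Or.inl hξ.1.ne')
  refine (h1.mul (hasDerivAt_eulerIntegral μ hs hν hξ.2)).congr_deriv ?_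
  have e := eulerIntegral_add_one (μ - 1) hs hν hξ.2
  have e2 := eulerIntegral_of_sum_eq (a := μ - 1) hs hν hξ.1.le hξ.2 (by linarith)
  have e3 : ξ ^ (-μ) = ξ ^ (-μ - 1) * ξ := by
    rw [← rpow_add_one hξ.1.ne']
    ring_nf
  rw [sub_add_cancel] at e
  simp only [id]
  rw [e3]
  linear_combination (-μ * ξ ^ (-μ - 1)) * e - (μ * ξ ^ (-μ - 1)) * e2

theorem tendsto_eulerIntegral_one_sub {s μ ν : ℝ} (hμ : -1 < μ) (hμ0 : μ < 0)
    (hν0 : ν ≤ 0) (hsum : s + μ + ν = 0) :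
    Filter.Tendsto (fun ξ => eulerIntegral s ν μ (1 - ξ)) (nhdsWithin 0 (Set.Ioi 0))
      (nhds (Gamma (μ + 1) * Gamma (-μ))) := by
  have hb := integral_beta (s := -μ) (b := μ) (by linarith) hμ
  rw [show μ + 1 + -μ = 1 by ring, Gamma_one, div_one] at hb
  rw [← hb]
  have hev : ∀ᶠ ξ : ℝ in nhdsWithin 0 (Set.Ioi 0), ξ ∈ Set.Ioo (0 : ℝ) 1 :=
    Ioo_mem_nhdsGT one_pos
  have hne : ∀ᵐ t : ℝ ∂volume, t ≠ 1 := by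
    rw [ae_iff]
    simp
  have hsplit : ∀ t : ℝ, t < 1 →
      t ^ μ * (1 - t) ^ (-μ - 1) = t ^ μ * (1 - t) ^ (s - 1) * (1 - t) ^ ν := fun t ht => by
    rw [mul_assoc, ← rpow_add (by linarith)]
    congr 2
    linarith
  refine intervalIntegral.tendsto_integral_filter_of_dominated_convergence
    (fun t => t ^ μ * (1 - t) ^ (-μ - 1)) ?_ ?_ (intervalIntegrable_beta (by linarith) hμ) ?_
  · refine Filter.Eventually.of_forall fun ξ => Measurable.aestronglyMeasurable ?_
    fun_prop
  · filter_upwards [hev] with ξ hξ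
    filter_upwards [hne] with t ht1 ht
    rw [Set.uIoc_of_le zero_le_one] at ht
    have ht' := lt_of_le_of_ne ht.2 ht1
    have hp : 0 ≤ t ^ μ * (1 - t) ^ (s - 1) :=
      mul_nonneg (rpow_nonneg ht.1.le _) (rpow_nonneg (by linarith) _)
    rw [hsplit t ht', Real.norm_of_nonneg (mul_nonneg hp (rpow_nonneg (by nlinarith [hξ.1, ht.1]) _))]
    exact mul_le_mul_of_nonneg_left
      (rpow_le_rpow_of_nonpos (by linarith) (by nlinarith [hξ.1, ht.1]) hν0) hp
  · filter_upwards [hne] with t ht1 ht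
    rw [Set.uIoc_of_le zero_le_one] at ht
    have ht' := lt_of_le_of_ne ht.2 ht1
    rw [hsplit t ht']
    have hc : ContinuousAt
        (fun ξ : ℝ => t ^ μ * (1 - t) ^ (s - 1) * (1 - (1 - ξ) * t) ^ ν) 0 := by
      refine continuousAt_const.mul (ContinuousAt.rpow_const (by fun_prop) (Or.inl ?_))
      simp only [sub_zero, one_mul]
      linarith
    have := hc.tendsto
    simp only [sub_zero, one_mul] at this
    exact this.mono_left nhdsWithin_le_nhds

theorem twoSidedMoment_zero {s μ ν ξ : ℝ} (hs : 0 < s) (hμ : -1 < μ) (hμ0 : μ ≤ 0)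
    (hν : -1 < ν) (hν0 : ν ≤ 0) (hsum : s + μ + ν = 0) (hξ : ξ ∈ Set.Ioo (0 : ℝ) 1) :
    twoSidedMoment s μ ν 0 ξ = -π := by
  rcases hμ0.eq_or_lt with rfl | hμ0
  · have hν' : ν = -s := by linarith
    have := integral_beta hs hν
    have h2 := sin_mul_Gamma_mul_Gamma hν (by linarith)
    simp only [twoSidedMoment, eulerIntegral]
    simp only [neg_zero, rpow_zero, Nat.cast_zero, add_zero, mul_zero, sin_zero, zero_mul, mul_one,
      one_mul, this]
    rw [show ν + 1 + s = 1 by linarith, Gamma_one, div_one, ← h2, show s = -ν by linarith]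
  have hderiv : ∀ η ∈ Set.Ioo (0 : ℝ) 1, HasDerivAt (twoSidedMoment s μ ν 0) 0 η := by
    intro η hη
    have h1 := hasDerivAt_rpow_mul_eulerIntegral hs hν hsum hη
    have h2 := hasDerivAt_rpow_mul_eulerIntegral (μ := ν) (ν := μ) (ξ := 1 - η) hs hμ
      (by linarith) ⟨by linarith [hη.2], by linarith [hη.1]⟩
    have h3 := h2.comp η ((hasDerivAt_id η).const_sub 1)
    have h4 := (h1.const_mul (sin (π * ν))).add (h3.const_mul (sin (π * μ)))
    have hf : twoSidedMoment s μ ν 0 = (fun ξ => sin (π * ν) * (ξ ^ (-μ) * eulerIntegral s μ ν ξ)) +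
        fun ξ => sin (π * μ) * ((1 - ξ) ^ (-ν) * eulerIntegral s ν μ (1 - ξ)) := by
      ext ξ
      simp [twoSidedMoment]
    rw [hf]
    refine h4.congr_deriv ?_
    have k1 := sin_mul_beta (μ := μ) hν hν0 hsum
    have k2 := sin_mul_beta (s := s) (μ := ν) hμ hμ0.le (by linarith)
    rw [sub_sub_cancel]
    linear_combination (-(η ^ (-μ - 1) * (1 - η) ^ (-ν - 1))) * k1 +
      (η ^ (-μ - 1) * (1 - η) ^ (-ν - 1)) * k2
  have hconst : ∀ η ∈ Set.Ioo (0 : ℝ) 1, twoSidedMoment s μ ν 0 η = twoSidedMoment s μ ν 0 ξ :=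
    fun η hη => isOpen_Ioo.is_const_of_deriv_eq_zero isPreconnected_Ioo
      (fun x hx => (hderiv x hx).differentiableAt.differentiableWithinAt)
      (fun x hx => (hderiv x hx).deriv) hη hξ
  have hlim : Filter.Tendsto (twoSidedMoment s μ ν 0) (nhdsWithin 0 (Set.Ioi 0)) (nhds (-π)) := by
    have hl : ContinuousAt (fun ξ : ℝ => ξ ^ (-μ) * eulerIntegral s μ ν ξ) 0 :=
      (continuousAt_id.rpow_const (Or.inr (by linarith))).mul
        (hasDerivAt_eulerIntegral μ hs hν one_pos).continuousAt
    have hl' := hl.tendsto.mono_left (nhdsWithin_le_nhds (s := Set.Ioi (0 : ℝ)))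
    rw [zero_rpow (by linarith), zero_mul] at hl'
    have hr : ContinuousAt (fun ξ : ℝ => (1 - ξ) ^ (-ν)) 0 :=
      ContinuousAt.rpow_const (by fun_prop) (Or.inl (by simp))
    have hr' := hr.tendsto.mono_left (nhdsWithin_le_nhds (s := Set.Ioi (0 : ℝ)))
    rw [sub_zero, one_rpow] at hr'
    have := (hl'.const_mul (sin (π * ν))).add
      ((hr'.mul (tendsto_eulerIntegral_one_sub hμ hμ0 hν0 hsum)).const_mul (sin (π * μ)))
    rw [mul_zero, zero_add, one_mul, sin_mul_Gamma_mul_Gamma hμ hμ0] at this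
    refine this.congr fun η => ?_
    simp [twoSidedMoment]
  refine tendsto_nhds_unique (tendsto_const_nhds.congr' ?_) hlim
  filter_upwards [Ioo_mem_nhdsGT one_pos] with η hη using (hconst η hη).symm

theorem twoSidedMoment_one {s μ ν ξ : ℝ} (hs : 0 < s) (hμ : -1 < μ) (hμ0 : μ ≤ 0)
    (hν : -1 < ν) (hν0 : ν ≤ 0) (hsum : s + μ + ν = 0) (hξ : ξ ∈ Set.Ioo (0 : ℝ) 1) :
    twoSidedMoment s μ ν 1 ξ =
      (-ν + (1 + μ + ν) * (1 - ξ)) * twoSidedMoment s μ ν 0 ξ := by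
  have hη : 1 - ξ ∈ Set.Ioo (0 : ℝ) 1 := ⟨by linarith [hξ.2], by linarith [hξ.1]⟩
  have l := eulerIntegral_add_two (μ - 1) hs hν hξ.2
  have r := eulerIntegral_add_two (ν - 1) hs hμ hη.2
  have r1 := eulerIntegral_add_one ν hs hμ hη.2
  have l0 := eulerIntegral_of_sum_eq (a := μ - 1) hs hν hξ.1.le hξ.2 (by linarith)
  have r0 := eulerIntegral_of_sum_eq (a := ν - 1) hs hμ hη.1.le hη.2 (by linarith)
  have k1 := sin_mul_beta (μ := μ) hν hν0 hsum
  have k2 := sin_mul_beta (s := s) (μ := ν) hμ hμ0 (by linarith)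
  rw [sub_add_cancel, show μ - 1 + 2 = μ + 1 by ring, l0] at l
  rw [sub_add_cancel, show ν - 1 + 2 = ν + 1 by ring, r0, sub_sub_cancel] at r
  have eξ : ξ ^ (-μ) = ξ ^ (-μ - 1) * ξ := by
    rw [← rpow_add_one hξ.1.ne']
    ring_nf
  have eη : (1 - ξ) ^ (-ν) = (1 - ξ) ^ (-ν - 1) * (1 - ξ) := by
    rw [← rpow_add_one hη.1.ne']
    ring_nf
  obtain rfl : s = -μ - ν := by linarith
  simp only [twoSidedMoment, Nat.cast_one, Nat.cast_zero, add_zero, pow_zero, pow_one, mul_one]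
  rw [eξ, eη]
  linear_combination (sin (π * ν) * (ξ ^ (-μ - 1) * ξ)) * l
    - (sin (π * μ) * ((1 - ξ) ^ (-ν - 1) * (1 - ξ))) * (r - r1)
    - (ξ ^ (-μ - 1) * ξ) * ((1 - ξ) ^ (-ν - 1) * (1 - ξ)) * (k1 - k2)

theorem twoSidedMoment_add_two {s μ ν ξ : ℝ} (hs : 0 < s) (hμ : -1 < μ)
    (hν : -1 < ν) (hsum : s + μ + ν = 0) (hξ : ξ ∈ Set.Ioo (0 : ℝ) 1) (m : ℕ) :
    (m + 2) * twoSidedMoment s μ ν (m + 2) ξ =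
      (m + 1 - ν + (m + 1 + (1 + μ + ν)) * (1 - ξ)) * twoSidedMoment s μ ν (m + 1) ξ
        - (1 - ξ) * (μ + m + 1) * twoSidedMoment s μ ν m ξ := by
  have hη : 1 - ξ ∈ Set.Ioo (0 : ℝ) 1 := ⟨by linarith [hξ.2], by linarith [hξ.1]⟩
  have l := eulerIntegral_add_two (μ + m) hs hν hξ.2
  have r := eulerIntegral_contiguous (b := μ + m) ν hs (by linarith [m.cast_nonneg (α := ℝ)]) hη.2
  obtain rfl : s = -μ - ν := by linarith
  simp only [twoSidedMoment]
  push_cast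
  simp only [← add_assoc]
  linear_combination (sin (π * ν) * ξ ^ (-μ)) * l +
    (sin (π * μ) * ((1 - ξ) ^ (-ν) * (1 - ξ) ^ (m + 1))) * r

/-- The coefficient `(c)_i / i!` of `X^i` in the binomial series of `(1 - X)^(-c)`. -/
def risingCoeff (c : ℝ) : ℕ → ℝ
  | 0 => 1
  | i + 1 => (i + c) / (i + 1) * risingCoeff c i

theorem risingCoeff_succ (c : ℝ) (i : ℕ) :
    (i + 1) * risingCoeff c (i + 1) = (i + c) * risingCoeff c i := by
  have : (i + 1 : ℝ) ≠ 0 := by positivity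
  rw [risingCoeff]
  field_simp

theorem risingCoeff_eq_Gamma {c : ℝ} (hc : 0 < c) (i : ℕ) :
    risingCoeff c i = Gamma (i + c) / (Gamma c * i.factorial) := by
  have h0 := (Gamma_pos_of_pos hc).ne'
  induction i with
  | zero => simp [risingCoeff, h0]
  | succ i ih =>
    have h1 : (i + c : ℝ) ≠ 0 := by positivity
    rw [risingCoeff, ih, Nat.factorial_succ]
    push_cast
    rw [show (i + 1 + c : ℝ) = i + c + 1 by ring, Gamma_add_one h1]
    field_simp

/-- The binomial series of `(1 - ηX)^(-c)`. -/
def risingSeries (c η : ℝ) : PowerSeries ℝ := PowerSeries.mk fun i => risingCoeff c i * η ^ i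

theorem derivative_risingSeries (c η : ℝ) :
    (1 - PowerSeries.C η * PowerSeries.X) * PowerSeries.derivative ℝ (risingSeries c η) =
      PowerSeries.C (c * η) * risingSeries c η := by
  ext i
  rw [sub_mul, one_mul, mul_assoc, map_sub, PowerSeries.coeff_C_mul, PowerSeries.coeff_C_mul,
    PowerSeries.coeff_derivative]
  rcases i with _ | i
  · have := risingCoeff_succ c 0
    simp [risingSeries] at this ⊢
    rw [this]
    ring
  · have := risingCoeff_succ c (i + 1)
    rw [PowerSeries.coeff_succ_X_mul, PowerSeries.coeff_derivative]
    simp only [risingSeries, PowerSeries.coeff_mk]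
    push_cast at this ⊢
    linear_combination η ^ (i + 2) * this

/-- The polynomials in `η` generated by `(1 - X)^(-c) (1 - ηX)^(-d)`. -/
def momentPoly (c d η : ℝ) (m : ℕ) : ℝ :=
  ∑ j ∈ Finset.range (m + 1), risingCoeff c (m - j) * risingCoeff d j * η ^ j

theorem momentPoly_eq_coeff (c d η : ℝ) (m : ℕ) :
    momentPoly c d η m = PowerSeries.coeff m (risingSeries d η * risingSeries c 1) := by
  rw [PowerSeries.coeff_mul, Finset.Nat.sum_antidiagonal_eq_sum_range_succ_mk, momentPoly]
  refine Finset.sum_congr rfl fun j _ => ?_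
  simp only [risingSeries, PowerSeries.coeff_mk, one_pow]
  ring

theorem momentPoly_zero (c d η : ℝ) : momentPoly c d η 0 = 1 := by
  simp [momentPoly, risingCoeff]

theorem momentPoly_one (c d η : ℝ) : momentPoly c d η 1 = c + d * η := by
  simp [momentPoly, risingCoeff, Finset.sum_range_succ]

theorem momentPoly_add_two (c d η : ℝ) (m : ℕ) :
    (m + 2) * momentPoly c d η (m + 2) =
      (m + 1 + c + (m + 1 + d) * η) * momentPoly c d η (m + 1)
        - η * (m + c + d) * momentPoly c d η m := by
  have hc := derivative_risingSeries c 1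
  have hd := derivative_risingSeries d η
  simp only [momentPoly_eq_coeff]
  set F := risingSeries c 1
  set G := risingSeries d η
  have hprod : PowerSeries.derivative ℝ (G * F)
        - PowerSeries.C (1 + η) * (PowerSeries.X * PowerSeries.derivative ℝ (G * F))
        + PowerSeries.C η * (PowerSeries.X * (PowerSeries.X * PowerSeries.derivative ℝ (G * F)))
      = PowerSeries.C (c + d * η) * (G * F)
        - PowerSeries.C (η * (c + d)) * (PowerSeries.X * (G * F)) := by
    rw [Derivation.leibniz, smul_eq_mul, smul_eq_mul]
    simp only [map_add, map_mul, map_one, mul_one, one_mul] at hc hd ⊢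
    linear_combination (1 - PowerSeries.C η * PowerSeries.X) * G * hc +
      (1 - PowerSeries.X) * F * hd
  have h := congrArg (PowerSeries.coeff (m + 1)) hprod
  rw [map_add, map_sub, map_sub] at h
  simp only [PowerSeries.coeff_C_mul, PowerSeries.coeff_succ_X_mul,
    PowerSeries.coeff_derivative] at h
  rcases m with _ | m
  · simp only [PowerSeries.coeff_zero_X_mul] at h
    push_cast at h ⊢
    simp only [zero_add] at h ⊢
    linear_combination h
  · simp only [PowerSeries.coeff_succ_X_mul, PowerSeries.coeff_derivative] at h
    push_cast at h ⊢
    linear_combination h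

theorem twoSidedMoment_eq {s μ ν ξ : ℝ} (hs : 0 < s) (hμ : -1 < μ) (hμ0 : μ ≤ 0)
    (hν : -1 < ν) (hν0 : ν ≤ 0) (hsum : s + μ + ν = 0) (hξ : ξ ∈ Set.Ioo (0 : ℝ) 1) (m : ℕ) :
    twoSidedMoment s μ ν m ξ = -π * momentPoly (-ν) (1 + μ + ν) (1 - ξ) m := by
  induction m using Nat.twoStepInduction with
  | zero => rw [twoSidedMoment_zero hs hμ hμ0 hν hν0 hsum hξ, momentPoly_zero, mul_one]
  | one =>
    rw [twoSidedMoment_one hs hμ hμ0 hν hν0 hsum hξ,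
      twoSidedMoment_zero hs hμ hμ0 hν hν0 hsum hξ, momentPoly_one]
    ring
  | more m ih0 ih1 =>
    have h := twoSidedMoment_add_two hs hμ hν hsum hξ m
    have h' := momentPoly_add_two (-ν) (1 + μ + ν) (1 - ξ) m
    rw [ih0, ih1] at h
    have h2 : (m + 2 : ℝ) ≠ 0 := by positivity
    apply mul_left_cancel₀ h2
    linear_combination h + π * h'

/-- The coefficient of `((x - 1)/2)^m` in the Jacobi polynomial `P_n^{a,b}`. -/
def jacobiCoeff (n : ℕ) (a b : ℝ) (m : ℕ) : ℝ :=
  (Real.Gamma (a + n + 1) * Real.Gamma (a + b + n + m + 1)) /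
    ((m.factorial : ℝ) * ((n - m).factorial : ℝ) * Real.Gamma (a + b + n + 1) *
      Real.Gamma (a + m + 1))

theorem jacobiCoeff_succ {n m : ℕ} {a b : ℝ} (ha : -1 < a) (hab : -1 < a + b) (hm : m < n) :
    (m + 1) * (m + 1 + a) * jacobiCoeff n a b (m + 1) =
      (n - m) * (n + m + a + b + 1) * jacobiCoeff n a b m := by
  obtain ⟨i, rfl⟩ : ∃ i, n = m + i + 1 := ⟨n - m - 1, by omega⟩
  have hi : (0 : ℝ) ≤ i := i.cast_nonneg
  have hm' : (0 : ℝ) ≤ m := m.cast_nonneg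
  unfold jacobiCoeff
  rw [show m + i + 1 - m = i + 1 by omega, show m + i + 1 - (m + 1) = i by omega,
    Nat.factorial_succ, Nat.factorial_succ]
  push_cast
  rw [show a + (m + 1 : ℝ) + 1 = (a + m + 1) + 1 by ring,
    show a + b + (m + i + 1 : ℝ) + (m + 1) + 1 = (a + b + (m + i + 1) + m + 1) + 1 by ring,
    Gamma_add_one (s := a + m + 1) (by linarith),
    Gamma_add_one (s := a + b + (m + i + 1) + m + 1) (by linarith)]
  have g1 := (Gamma_pos_of_pos (s := a + m + 1) (by linarith)).ne'
  have g2 := (Gamma_pos_of_pos (s := a + b + (m + i + 1) + 1) (by linarith)).ne'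
  have n1 : a + m + 1 ≠ 0 := by linarith
  have n2 : (m + 1 : ℝ) ≠ 0 := by linarith
  have n3 : (i + 1 : ℝ) ≠ 0 := by linarith
  field_simp
  ring

/-- The coefficient of `η^j` in `momentPoly (-ν) (1 + μ + ν) η m`. -/
def momentCoeff (μ ν : ℝ) (m j : ℕ) : ℝ :=
  if j ≤ m then risingCoeff (-ν) (m - j) * risingCoeff (1 + μ + ν) j else 0

/-- The moment map intertwines the Jacobi differential operators with parameters `(μ, ν)` and
`(ν, μ)`. -/
theorem momentCoeff_succ (μ ν : ℝ) (m j : ℕ) :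
    (j + 1) * (j + 1 + ν) * momentCoeff μ ν (m + 1) (j + 1)
        - j * (j + (1 + μ + ν)) * momentCoeff μ ν (m + 1) j =
      (m + 1) * (m + 1 + μ) * momentCoeff μ ν m j
        - (m + 1) * (m + 1 + (1 + μ + ν)) * momentCoeff μ ν (m + 1) j := by
  rcases le_or_gt j m with h | h
  · obtain ⟨i, rfl⟩ := Nat.exists_eq_add_of_le h
    have e1 := risingCoeff_succ (-ν) i
    have e2 := risingCoeff_succ (1 + μ + ν) j
    simp only [momentCoeff, if_pos h, if_pos (show j ≤ j + i + 1 by omega),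
      if_pos (show j + 1 ≤ j + i + 1 by omega), show j + i + 1 - (j + 1) = i by omega,
      show j + i + 1 - j = i + 1 by omega, show j + i - j = i by omega]
    push_cast
    linear_combination ((j + 1 + ν) * risingCoeff (-ν) i) * e2 +
      ((2 * j + i + 1 + (1 + μ + ν)) * risingCoeff (1 + μ + ν) j) * e1
  · have z1 : momentCoeff μ ν m j = 0 := if_neg (by omega)
    have z2 : momentCoeff μ ν (m + 1) (j + 1) = 0 := if_neg (by omega)
    rw [z1, z2]
    rcases eq_or_ne j (m + 1) with rfl | h'
    · push_cast
      ring
    · have z3 : momentCoeff μ ν (m + 1) j = 0 := if_neg (by omega)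
      rw [z3]
      ring

theorem momentPoly_eq_sum {n m : ℕ} (hm : m ≤ n) (μ ν η : ℝ) :
    momentPoly (-ν) (1 + μ + ν) η m =
      ∑ j ∈ Finset.range (n + 1), momentCoeff μ ν m j * η ^ j := by
  rw [momentPoly]
  refine Finset.sum_subset_zero_on_sdiff (Finset.range_mono (by omega)) (fun j hj => ?_)
    fun j hj => ?_
  · simp only [Finset.mem_sdiff, Finset.mem_range] at hj
    rw [momentCoeff, if_neg (by omega), zero_mul]
  · rw [Finset.mem_range] at hj
    rw [momentCoeff, if_pos (by omega)]

theorem sum_jacobiCoeff_mul_momentCoeff {n j : ℕ} {μ ν : ℝ} (hμ : -1 < μ) (hν : -1 < ν)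
    (hμν : -1 < μ + ν) (hj : j ≤ n) :
    ∑ m ∈ Finset.range (n + 1), (-1) ^ m * jacobiCoeff n μ ν m * momentCoeff μ ν m j =
      risingCoeff (1 + μ + ν) n * ((-1) ^ j * jacobiCoeff n ν μ j) := by
  have hrec : ∀ j : ℕ, (j + 1) * (j + 1 + ν) *
        ∑ m ∈ Finset.range (n + 1), (-1) ^ m * jacobiCoeff n μ ν m * momentCoeff μ ν m (j + 1) =
      (j * (j + (1 + μ + ν)) - n * (n + (1 + μ + ν))) *
        ∑ m ∈ Finset.range (n + 1), (-1) ^ m * jacobiCoeff n μ ν m * momentCoeff μ ν m j := by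
    intro j
    have hleft : ∑ m ∈ Finset.range (n + 1), (-1) ^ m * jacobiCoeff n μ ν m *
        ((j + 1) * (j + 1 + ν) * momentCoeff μ ν m (j + 1)
          - j * (j + (1 + μ + ν)) * momentCoeff μ ν m j
          + m * (m + (1 + μ + ν)) * momentCoeff μ ν m j) =
        ∑ m ∈ Finset.range (n + 1), (-1) ^ m * jacobiCoeff n μ ν m *
          ((m * (m + (1 + μ + ν)) - n * (n + (1 + μ + ν))) * momentCoeff μ ν m j) := by
      rw [Finset.sum_range_succ', Finset.sum_range_succ _ n, sub_self, zero_mul, mul_zero]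
      congr 1
      · refine Finset.sum_congr rfl fun m hm => ?_
        have h1 := momentCoeff_succ μ ν m j
        have h2 := jacobiCoeff_succ hμ hμν (Finset.mem_range.1 hm)
        push_cast
        linear_combination ((-1) ^ (m + 1) * jacobiCoeff n μ ν (m + 1)) * h1 -
          ((-1) ^ m * momentCoeff μ ν m j) * h2
      · rcases j with _ | j <;> simp [momentCoeff]
    rw [Finset.mul_sum, Finset.mul_sum, ← sub_eq_zero, ← Finset.sum_sub_distrib]
    rw [← sub_eq_zero, ← Finset.sum_sub_distrib] at hleft
    rw [← hleft]
    refine Finset.sum_congr rfl fun m _ => ?_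
    ring
  suffices h : ∀ i j : ℕ, i + j = n →
      ∑ m ∈ Finset.range (n + 1), (-1) ^ m * jacobiCoeff n μ ν m * momentCoeff μ ν m j =
      risingCoeff (1 + μ + ν) n * ((-1) ^ j * jacobiCoeff n ν μ j) from
    h (n - j) j (by omega)
  intro i
  induction i with
  | zero =>
    rintro j hj
    obtain rfl : j = n := by omega
    rw [Finset.sum_range_succ, Finset.sum_eq_zero, zero_add]
    · have e : jacobiCoeff j μ ν j = jacobiCoeff j ν μ j := by
        have g1 := (Gamma_pos_of_pos (s := μ + j + 1) (by linarith [j.cast_nonneg (α := ℝ)])).ne'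
        have g2 := (Gamma_pos_of_pos (s := ν + j + 1) (by linarith [j.cast_nonneg (α := ℝ)])).ne'
        unfold jacobiCoeff
        rw [add_comm ν μ]
        field_simp
      simp only [momentCoeff, if_pos le_rfl, Nat.sub_self, e, risingCoeff]
      ring
    · intro m hm
      rw [Finset.mem_range] at hm
      rw [momentCoeff, if_neg (by omega), mul_zero]
  | succ i ih =>
    intro j hj
    have h1 := hrec j
    rw [ih (j + 1) (by omega)] at h1
    have h2 := jacobiCoeff_succ (n := n) (m := j) hν (by linarith) (by omega) (b := μ)
    have hjn : (j : ℝ) + 1 ≤ n := by exact_mod_cast (by omega : j + 1 ≤ n)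
    have hj0 : (0 : ℝ) ≤ j := j.cast_nonneg
    have hne : (j * (j + (1 + μ + ν)) - n * (n + (1 + μ + ν)) : ℝ) ≠ 0 := by
      have : (j * (j + (1 + μ + ν)) - n * (n + (1 + μ + ν)) : ℝ) =
        -((n - j) * (n + j + (1 + μ + ν))) := by ring
      rw [this]
      exact neg_ne_zero.2 (mul_ne_zero (by linarith) (by linarith))
    apply mul_left_cancel₀ hne
    rw [← h1]
    linear_combination (risingCoeff (1 + μ + ν) n * (-1) ^ (j + 1)) * h2

theorem jacobiP_eq_sum (n : ℕ) (a b x : ℝ) :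
    jacobiP n a b x =
      ∑ m ∈ Finset.range (n + 1), (-1) ^ m * jacobiCoeff n a b m * ((1 - x) / 2) ^ m := by
  refine Finset.sum_congr rfl fun m _ => ?_
  rw [show (x - 1) / 2 = -1 * ((1 - x) / 2) by ring, mul_pow, jacobiCoeff]
  ring

theorem sum_jacobiCoeff_mul_twoSidedMoment {n : ℕ} {s μ ν ξ : ℝ} (hs : 0 < s) (hμ : -1 < μ)
    (hμ0 : μ ≤ 0) (hν : -1 < ν) (hν0 : ν ≤ 0) (hμν : -1 < μ + ν) (hsum : s + μ + ν = 0)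
    (hξ : ξ ∈ Set.Ioo (0 : ℝ) 1) :
    ∑ m ∈ Finset.range (n + 1), (-1) ^ m * jacobiCoeff n μ ν m * twoSidedMoment s μ ν m ξ =
      -π * risingCoeff (1 + μ + ν) n * jacobiP n ν μ (2 * ξ - 1) := by
  rw [jacobiP_eq_sum, show (1 - (2 * ξ - 1)) / 2 = 1 - ξ by ring, Finset.mul_sum]
  calc _ = ∑ m ∈ Finset.range (n + 1), ∑ j ∈ Finset.range (n + 1),
        -π * ((-1) ^ m * jacobiCoeff n μ ν m * momentCoeff μ ν m j) * (1 - ξ) ^ j := by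
        refine Finset.sum_congr rfl fun m hm => ?_
        rw [twoSidedMoment_eq hs hμ hμ0 hν hν0 hsum hξ,
          momentPoly_eq_sum (Nat.lt_succ_iff.1 (Finset.mem_range.1 hm)), Finset.mul_sum,
          Finset.mul_sum]
        exact Finset.sum_congr rfl fun j _ => by ring
    _ = _ := by
        rw [Finset.sum_comm]
        refine Finset.sum_congr rfl fun j hj => ?_
        rw [← Finset.sum_mul, ← Finset.mul_sum, sum_jacobiCoeff_mul_momentCoeff hμ hν hμν
          (Nat.lt_succ_iff.1 (Finset.mem_range.1 hj))]
        ring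

theorem integral_left_Jpf {n : ℕ} {s μ ν ξ : ℝ} (hs : 0 < s) (hν : -1 < ν)
    (hsum : s + μ + ν = 0) (hξ : ξ ∈ Set.Ioo (0 : ℝ) 1) :
    ∫ y in (-1 : ℝ)..(2 * ξ - 1), (2 * ξ - 1 - y) ^ (s - 1) * Jpf n μ ν y =
      ∑ m ∈ Finset.range (n + 1), (-1) ^ m * jacobiCoeff n μ ν m *
        (ξ ^ (-μ) * eulerIntegral s (μ + m) ν ξ) := by
  have hξ0 := hξ.1
  have h := intervalIntegral.smul_integral_comp_add_mul (a := 0) (b := 1)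
    (fun y => (2 * ξ - 1 - y) ^ (s - 1) * Jpf n μ ν y) (2 * ξ) (-1)
  rw [mul_zero, add_zero, mul_one, show -1 + 2 * ξ = 2 * ξ - 1 by ring] at h
  rw [← h, smul_eq_mul, ← intervalIntegral.integral_const_mul]
  simp only [eulerIntegral, ← intervalIntegral.integral_const_mul]
  rw [← intervalIntegral.integral_finsetSum fun m _ =>
    ((intervalIntegrable_euler _ hs hν hξ.2).const_mul _).const_mul _]
  rw [intervalIntegral.integral_of_le zero_le_one, intervalIntegral.integral_of_le zero_le_one]
  refine setIntegral_congr_fun measurableSet_Ioc fun t ht => ?_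
  have h1 := one_sub_mul_pos hξ.2 (Ioc_subset_Icc_self ht)
  have ht1 : 0 ≤ 1 - t := by linarith [ht.2]
  have c : 2 * ξ * ((2 * ξ) ^ (s - 1) * (2 ^ μ * (2 * ξ) ^ ν)) = ξ ^ (-μ) := by
    have : 2 * ξ * ((2 * ξ) ^ (s - 1) * (2 * ξ) ^ ν) = 2 ^ (-μ) * ξ ^ (-μ) := by
      rw [← rpow_add (by positivity), mul_comm, ← rpow_add_one (by positivity),
        ← mul_rpow zero_le_two hξ0.le]
      congr 1
      linarith
    have h2 : (2 : ℝ) ^ (-μ) * 2 ^ μ = 1 := by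
      rw [← rpow_add two_pos, neg_add_cancel, rpow_zero]
    linear_combination 2 ^ μ * this + ξ ^ (-μ) * h2
  simp only [Jpf, jacobiP_eq_sum]
  rw [show 2 * ξ - 1 - (-1 + 2 * ξ * t) = 2 * ξ * (1 - t) by ring,
    show 1 - (-1 + 2 * ξ * t) = 2 * (1 - ξ * t) by ring,
    show 1 + (-1 + 2 * ξ * t) = 2 * ξ * t by ring,
    mul_rpow (by positivity) ht1, mul_rpow zero_le_two h1.le, mul_rpow (by positivity) ht.1.le,
    mul_div_cancel_left₀ _ two_ne_zero, ← c]
  simp only [Finset.mul_sum]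
  refine Finset.sum_congr rfl fun m _ => ?_
  rw [rpow_add_natCast h1.ne']
  ring

theorem integral_right_Jpf {n : ℕ} {s μ ν ξ : ℝ} (hs : 0 < s) (hμ : -1 < μ)
    (hsum : s + μ + ν = 0) (hξ : ξ ∈ Set.Ioo (0 : ℝ) 1) :
    ∫ y in (2 * ξ - 1)..(1 : ℝ), (y - (2 * ξ - 1)) ^ (s - 1) * Jpf n μ ν y =
      ∑ m ∈ Finset.range (n + 1), (-1) ^ m * jacobiCoeff n μ ν m *
        ((1 - ξ) ^ (-ν) * (1 - ξ) ^ m * eulerIntegral s ν (μ + m) (1 - ξ)) := by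
  obtain ⟨η, rfl⟩ : ∃ η, ξ = 1 - η := ⟨1 - ξ, by ring⟩
  have hη0 : 0 < η := by linarith [hξ.2]
  have hη1 : η < 1 := by linarith [hξ.1]
  rw [sub_sub_cancel]
  have h := intervalIntegral.smul_integral_comp_add_mul (a := 0) (b := 1)
    (fun y => (y - (2 * (1 - η) - 1)) ^ (s - 1) * Jpf n μ ν y) (-(2 * η)) 1
  rw [mul_zero, add_zero, mul_one, show 1 + -(2 * η) = 2 * (1 - η) - 1 by ring, smul_eq_mul] at h
  rw [intervalIntegral.integral_symm, ← h, ← neg_mul, neg_neg,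
    ← intervalIntegral.integral_const_mul]
  simp only [eulerIntegral, ← intervalIntegral.integral_const_mul]
  rw [← intervalIntegral.integral_finsetSum fun m _ =>
    ((intervalIntegrable_euler _ hs (by linarith [m.cast_nonneg (α := ℝ)]) hη1).const_mul
      _).const_mul _]
  rw [intervalIntegral.integral_of_le zero_le_one, intervalIntegral.integral_of_le zero_le_one]
  refine setIntegral_congr_fun measurableSet_Ioc fun t ht => ?_
  have h1 := one_sub_mul_pos hη1 (Ioc_subset_Icc_self ht)
  have ht1 : 0 ≤ 1 - t := by linarith [ht.2]
  have c : 2 * η * ((2 * η) ^ (s - 1) * ((2 * η) ^ μ * 2 ^ ν)) = η ^ (-ν) := by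
    have : 2 * η * ((2 * η) ^ (s - 1) * (2 * η) ^ μ) = 2 ^ (-ν) * η ^ (-ν) := by
      rw [← rpow_add (by positivity), mul_comm, ← rpow_add_one (by positivity),
        ← mul_rpow zero_le_two hη0.le]
      congr 1
      linarith
    have h2 : (2 : ℝ) ^ (-ν) * 2 ^ ν = 1 := by
      rw [← rpow_add two_pos, neg_add_cancel, rpow_zero]
    linear_combination 2 ^ ν * this + η ^ (-ν) * h2
  simp only [Jpf, jacobiP_eq_sum]
  rw [show 1 + -(2 * η) * t - (2 * (1 - η) - 1) = 2 * η * (1 - t) by ring,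
    show 1 - (1 + -(2 * η) * t) = 2 * η * t by ring,
    show 1 + (1 + -(2 * η) * t) = 2 * (1 - η * t) by ring,
    mul_rpow (by positivity) ht1, mul_rpow zero_le_two h1.le, mul_rpow (by positivity) ht.1.le,
    show 2 * η * t / 2 = η * t by ring, ← c]
  simp only [Finset.mul_sum]
  refine Finset.sum_congr rfl fun m _ => ?_
  rw [rpow_add_natCast ht.1.ne', mul_pow]
  ring

/-- The two-sided fractional integral maps Jacobi poly-fractonomials to Jacobi polynomials. -/
theorem Ip_Jpf {α p μ ν : ℝ} (hα1 : 1 < α) (hα2 : α < 2)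
    (hμ1 : α - 2 ≤ μ) (hμ2 : μ ≤ 0) (hν1 : α - 2 ≤ ν) (hν2 : ν ≤ 0) (hsum : μ + ν = α - 2)
    (hbal : p * Real.sin (π * μ) = (1 - p) * Real.sin (π * ν)) (n : ℕ) {x : ℝ}
    (hx : x ∈ Set.Ioo (-1 : ℝ) 1) :
    Ip α μ ν p (2 - α) (Jpf n μ ν) x =
      Real.Gamma (n + α - 1) / Real.Gamma (n + 1) * jacobiP n ν μ x := by
  obtain ⟨ξ, rfl⟩ : ∃ ξ, x = 2 * ξ - 1 := ⟨(x + 1) / 2, by ring⟩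
  have hξ : ξ ∈ Set.Ioo (0 : ℝ) 1 := ⟨by linarith [hx.1], by linarith [hx.2]⟩
  have hs : 0 < 2 - α := by linarith
  have hl := integral_left_Jpf (n := n) (μ := μ) hs (by linarith : -1 < ν) (by linarith) hξ
  have hr := integral_right_Jpf (n := n) (ν := ν) hs (by linarith : -1 < μ) (by linarith) hξ
  have hS := sum_jacobiCoeff_mul_twoSidedMoment (n := n) hs (by linarith : -1 < μ) hμ2
    (by linarith : -1 < ν) hν2 (by linarith) (by linarith) hξ
  simp only [twoSidedMoment, mul_add, Finset.sum_add_distrib, mul_left_comm _ (sin _) _,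
    ← Finset.mul_sum] at hS
  rw [← hl, ← hr, show 1 + μ + ν = α - 1 by linarith, risingCoeff_eq_Gamma (by linarith)] at hS
  have hrefl := Real.Gamma_mul_Gamma_one_sub (2 - α)
  have hsinα : sin (π * (2 - α)) = -sin (π * α) := by
    rw [show π * (2 - α) = 2 * π - π * α by ring, sin_two_pi_sub]
  have hsin : 0 < sin (π * (2 - α)) :=
    sin_pos_of_pos_of_lt_pi (mul_pos pi_pos hs) (by nlinarith [pi_pos])
  rw [show 1 - (2 - α) = α - 1 by ring] at hrefl
  have g1 := (Gamma_pos_of_pos hs).ne'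
  have g2 := (Gamma_pos_of_pos (show 0 < α - 1 by linarith)).ne'
  rw [Ip, Il, Ir, if_neg hs.ne', if_neg hs.ne', Gamma_nat_eq_factorial, Cap,
    show sin (π * α) = -sin (π * (2 - α)) by rw [hsinα, neg_neg]]
  rw [show (n : ℝ) + (α - 1) = n + α - 1 by ring] at hS
  rw [eq_div_iff hsin.ne'] at hrefl
  set L := ∫ y in (-1 : ℝ)..(2 * ξ - 1), (2 * ξ - 1 - y) ^ (2 - α - 1) * Jpf n μ ν y
  set R := ∫ y in (2 * ξ - 1)..(1 : ℝ), (y - (2 * ξ - 1)) ^ (2 - α - 1) * Jpf n μ ν y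
  have hcomb : (sin (π * μ) + sin (π * ν)) * (p * L + (1 - p) * R) =
      sin (π * ν) * L + sin (π * μ) * R := by
    linear_combination (L - R) * hbal
  have hfac : (n.factorial : ℝ) ≠ 0 := by positivity
  have hsn := hsin.ne'
  calc _ = -((sin (π * μ) + sin (π * ν)) * (p * L + (1 - p) * R)) /
        (sin (π * (2 - α)) * Gamma (2 - α)) := by
        field_simp
    _ = π / (Gamma (2 - α) * Gamma (α - 1) * sin (π * (2 - α))) *
        (Gamma (n + α - 1) / n.factorial * jacobiP n ν μ (2 * ξ - 1)) := by
        rw [hcomb, hS]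
        field_simp
    _ = _ := by
        rw [hrefl, div_self pi_ne_zero, one_mul]

theorem hasDerivAt_jacobiP (n : ℕ) {a b : ℝ} (hab : -1 < a + b) (x : ℝ) :
    HasDerivAt (jacobiP (n + 1) a b)
      ((a + b + n + 2) / 2 * jacobiP n (a + 1) (b + 1) x) x := by
  have h : HasDerivAt (fun x => ∑ m ∈ Finset.range (n + 1 + 1),
      jacobiCoeff (n + 1) a b m * ((x - 1) / 2) ^ m)
      (∑ m ∈ Finset.range (n + 1 + 1),
        jacobiCoeff (n + 1) a b m * (m * ((x - 1) / 2) ^ (m - 1) * (1 / 2))) x :=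
    HasDerivAt.fun_sum fun m _ =>
      ((((hasDerivAt_id x).sub_const 1).div_const 2).pow m).const_mul _
  refine h.congr_deriv ?_
  rw [Finset.sum_range_succ', Nat.cast_zero, zero_mul, zero_mul, mul_zero, add_zero, jacobiP,
    Finset.mul_sum]
  refine Finset.sum_congr rfl fun m hm => ?_
  have hn : (0 : ℝ) ≤ n := n.cast_nonneg
  have hm' : (m + 1 : ℝ) ≠ 0 := by positivity
  have hg : Gamma (a + 1 + (b + 1) + n + 1) = (a + b + n + 2) * Gamma (a + b + (n + 1) + 1) := by
    rw [show a + 1 + (b + 1) + n + 1 = (a + b + (n + 1) + 1) + 1 by ring,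
      Gamma_add_one (by linarith)]
    ring
  have h0 : a + b + n + 2 ≠ 0 := by linarith
  rw [hg, jacobiCoeff, Nat.factorial_succ, show n + 1 - (m + 1) = n - m by omega,
    Nat.add_sub_cancel]
  push_cast
  rw [show a + 1 + n + 1 = a + (n + 1 : ℝ) + 1 by ring,
    show a + 1 + (b + 1) + n + m + 1 = a + b + (n + 1 : ℝ) + (m + 1) + 1 by ring,
    show a + 1 + m + 1 = a + (m + 1 : ℝ) + 1 by ring]
  field_simp

theorem iteratedDeriv_jacobiP {n k : ℕ} (hk : k ≤ n) {a b : ℝ} (hab : -1 < a + b) :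
    iteratedDeriv k (jacobiP n a b) = fun x =>
      Gamma (a + b + n + k + 1) / (2 ^ k * Gamma (a + b + n + 1)) *
        jacobiP (n - k) (a + k) (b + k) x := by
  have hn : (0 : ℝ) ≤ n := n.cast_nonneg
  induction k with
  | zero =>
    have := (Gamma_pos_of_pos (show 0 < a + b + n + 1 by linarith)).ne'
    ext x
    simp [this]
  | succ k ih =>
    obtain ⟨i, rfl⟩ : ∃ i, n = k + i + 1 := ⟨n - k - 1, by omega⟩
    have hk' : (0 : ℝ) ≤ k := k.cast_nonneg
    rw [iteratedDeriv_succ, ih (by omega)]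
    ext x
    rw [show k + i + 1 - k = i + 1 by omega, show k + i + 1 - (k + 1) = i by omega,
      ((hasDerivAt_jacobiP i (show -1 < a + k + (b + k) by linarith) x).const_mul _).deriv]
    push_cast at hn ⊢
    rw [show a + b + (k + i + 1 : ℝ) + (k + 1) + 1 = (a + b + (k + i + 1) + k + 1) + 1 by ring,
      Gamma_add_one (s := a + b + (k + i + 1) + k + 1) (by linarith), ← add_assoc a, ← add_assoc b, pow_succ]
    field_simp
    ring

theorem statement3 (α p μ ν : ℝ)
    (hα1 : 1 < α) (hα2 : α < 2) (hp0 : 0 ≤ p) (hp1 : p ≤ 1)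
    (hμ1 : α - 2 ≤ μ) (hμ2 : μ ≤ 0) (hν1 : α - 2 ≤ ν) (hν2 : ν ≤ 0)
    (hsum : μ + ν = α - 2)
    (hbal : p * Real.sin (π * μ) = (1 - p) * Real.sin (π * ν))
    (k n : ℕ) (hk : 1 ≤ k) (hn : k ≤ n) (x : ℝ) (hx : x ∈ Set.Ioo (-1 : ℝ) 1) :
    iteratedDeriv k (Ip α μ ν p (2 - α) (Jpf n μ ν)) x =
      (Real.Gamma (n + k + α - 1) / (2 ^ k * Real.Gamma (n + 1))) *
        jacobiP (n - k) (ν + k) (μ + k) x := by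
  have heq : Ip α μ ν p (2 - α) (Jpf n μ ν) =ᶠ[nhds x] fun x =>
      Real.Gamma (n + α - 1) / Real.Gamma (n + 1) * jacobiP n ν μ x := by
    filter_upwards [isOpen_Ioo.mem_nhds hx] with y hy
    exact Ip_Jpf hα1 hα2 hμ1 hμ2 hν1 hν2 hsum hbal n hy
  have hn0 : (0 : ℝ) ≤ n := n.cast_nonneg
  have hg := (Gamma_pos_of_pos (show 0 < n + α - 1 by linarith)).ne'
  rw [heq.iteratedDeriv_eq k, iteratedDeriv_const_mul_field,
    iteratedDeriv_jacobiP hn (by linarith), show ν + μ + n + k + 1 = n + k + α - 1 by linarith,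
    show ν + μ + n + 1 = n + α - 1 by linarith]
  field_simp
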